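/- The power series ∑_{k=0}^∞ a_k·s^k with a_k := binom(1/2, k)·c_k and c_k := ∫₀^{2π} (cos t)^k dt has radius of convergence exactly 1: for every real r with 0 ≤ r < 1 the series ∑_k |a_k|·r^k converges, while for every real r > 1 the sequence (|a_k|·r^k) is unbounded (so ∑_k |a_k|·r^k diverges). -/

import Mathlib

open Complex intervalIntegral

/-- The moments `c_k = ∫₀^{2π} (cos t)^k dt`. -/
noncomputable def cCoef (k : ℕ) : ℝ :=
  ∫ t in (0:ℝ)..(2 * Real.pi), Real.cos t ^ k

/-- The generalized binomial coefficient `binom(1/2, k) = (∏_{j<k} (1/2 − j)) / k!`. -/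
noncomputable def halfBinom (k : ℕ) : ℝ :=
  (∏ j ∈ Finset.range k, ((1 : ℝ) / 2 - (j : ℝ))) / (Nat.factorial k)

/-- The Taylor coefficients `a_k = binom(1/2, k) · c_k` of
`g(s) = ∫₀^{2π} (1 − s·cos t)^{1/2} dt` at `0`. -/
noncomputable def aCoef (k : ℕ) : ℝ := halfBinom k * cCoef k

lemma halfBinom_succ (k : ℕ) :
    halfBinom (k + 1) = halfBinom k * ((1 / 2 - (k : ℝ)) / (k + 1)) := by
  unfold halfBinom
  rw [Finset.prod_range_succ, Nat.factorial_succ]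
  have : (Nat.factorial k : ℝ) ≠ 0 := by positivity
  push_cast
  field_simp

lemma halfBinom_zero : halfBinom 0 = 1 := by simp [halfBinom]

lemma abs_halfBinom_le (k : ℕ) : |halfBinom k| ≤ 1 := by
  induction k with
  | zero => simp [halfBinom_zero]
  | succ k ih =>
    rw [halfBinom_succ, abs_mul]
    have hk : (0 : ℝ) ≤ k := Nat.cast_nonneg k
    have h : |(1 / 2 - (k : ℝ)) / (k + 1)| ≤ 1 := by
      rw [abs_div, abs_of_pos (by positivity : (0 : ℝ) < k + 1), div_le_one (by positivity), abs_le]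
      constructor <;> linarith
    exact mul_le_one₀ ih (abs_nonneg _) h

lemma le_abs_halfBinom (k : ℕ) : 1 / (2 * ((k : ℝ) + 1) ^ 2) ≤ |halfBinom (k + 1)| := by
  induction k with
  | zero =>
    rw [halfBinom_succ, halfBinom_zero]
    norm_num
  | succ k ih =>
    rw [halfBinom_succ, abs_mul]
    have hk : (0 : ℝ) ≤ k := Nat.cast_nonneg k
    have h : |(1 / 2 - ((k + 1 : ℕ) : ℝ)) / ((k + 1 : ℕ) + 1)| = (k + 1 / 2) / (k + 2) := by
      push_cast
      rw [abs_div, abs_of_pos (by positivity : (0 : ℝ) < k + 1 + 1), abs_of_nonpos (by linarith)]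
      congr 1 <;> ring
    rw [h]
    refine le_trans ?_ (mul_le_mul_of_nonneg_right ih (by positivity))
    push_cast
    rw [div_mul_div_comm, div_le_div_iff₀ (by positivity) (by positivity)]
    have : 0 ≤ ((k : ℝ) + 2) * k := by positivity
    nlinarith

lemma cCoef_zero : cCoef 0 = 2 * Real.pi := by simp [cCoef]

lemma cCoef_add_two (n : ℕ) : cCoef (n + 2) = ((n : ℝ) + 1) / (n + 2) * cCoef n := by
  unfold cCoef
  rw [integral_cos_pow]
  simp

lemma le_cCoef (m : ℕ) : 2 * Real.pi / ((m : ℝ) + 1) ≤ cCoef (2 * m) := by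
  induction m with
  | zero => simp [cCoef_zero]
  | succ m ih =>
    rw [mul_add, mul_one, cCoef_add_two]
    refine le_trans ?_ (mul_le_mul_of_nonneg_left ih (by positivity))
    have := Real.pi_pos
    push_cast
    rw [div_mul_div_comm, div_le_div_iff₀ (by positivity) (by positivity)]
    have : 0 ≤ Real.pi * m := by positivity
    nlinarith

lemma abs_cCoef_le (k : ℕ) : |cCoef k| ≤ 2 * Real.pi := by
  have h := intervalIntegral.norm_integral_le_of_norm_le_const (a := 0) (b := 2 * Real.pi)
    (f := fun t => Real.cos t ^ k) (C := 1) (fun t _ => by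
      rw [norm_pow]
      exact pow_le_one₀ (norm_nonneg _) (Real.abs_cos_le_one t))
  have := Real.pi_pos
  rw [Real.norm_eq_abs, one_mul, sub_zero,
    abs_of_pos (by positivity : (0 : ℝ) < 2 * Real.pi)] at h
  exact h

lemma le_abs_aCoef (m : ℕ) : 1 / ((2 * m + 2 : ℕ) : ℝ) ^ 3 ≤ |aCoef (2 * m + 2)| := by
  have h1 := le_abs_halfBinom (2 * m + 1)
  have h2 := (le_cCoef (m + 1)).trans (le_abs_self _)
  rw [aCoef, abs_mul]
  have hp := Real.pi_gt_three
  refine le_trans ?_ (mul_le_mul h1 h2 (by positivity) (abs_nonneg _))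
  push_cast
  rw [div_mul_div_comm, div_le_div_iff₀ (by positivity) (by positivity)]
  have e : ((2 * m + 1 + 1 : ℝ)) = 2 * m + 2 := by ring
  rw [e]
  have hm : (0 : ℝ) ≤ m := Nat.cast_nonneg m
  have : (m : ℝ) + 1 + 1 ≤ Real.pi * (2 * m + 2) := by nlinarith
  have := mul_le_mul_of_nonneg_left this (by positivity : (0 : ℝ) ≤ 2 * (2 * m + 2) ^ 2)
  linarith

/-- The power series `∑_k a_k s^k` has radius of convergence exactly `1`. -/
theorem aCoef_radius_one :
    (∀ r : ℝ, 0 ≤ r → r < 1 → Summable (fun k : ℕ => |aCoef k| * r ^ k)) ∧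
    (∀ r : ℝ, 1 < r → ¬ BddAbove (Set.range fun k : ℕ => |aCoef k| * r ^ k)) := by
  constructor
  · intro r h0 h1
    refine Summable.of_nonneg_of_le (fun k => by positivity) (fun k => ?_)
      ((summable_geometric_of_lt_one h0 h1).mul_left (2 * Real.pi))
    refine mul_le_mul_of_nonneg_right ?_ (by positivity)
    rw [aCoef, abs_mul]
    have := mul_le_mul (abs_halfBinom_le k) (abs_cCoef_le k) (abs_nonneg _) zero_le_one
    linarith
  · rintro r hr ⟨M, hM⟩
    have hM' : ∀ k, |aCoef k| * r ^ k ≤ M := fun k => hM ⟨k, rfl⟩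
    have hM0 : 0 ≤ M := le_trans (by positivity) (hM' 0)
    have ht := tendsto_pow_const_div_const_pow_of_one_lt 3 hr
    have hev := ht.eventually (gt_mem_nhds (by positivity : (0 : ℝ) < 1 / (M + 1)))
    obtain ⟨N, hN⟩ := Filter.eventually_atTop.1 hev
    have h1 := hN (2 * N + 2) (by omega)
    have h2 := (mul_le_mul_of_nonneg_right (le_abs_aCoef N)
      (by positivity : 0 ≤ r ^ (2 * N + 2))).trans (hM' _)
    have hr0 : 0 < r ^ (2 * N + 2) := by positivity
    have hn : (0 : ℝ) < ((2 * N + 2 : ℕ) : ℝ) ^ 3 := by positivity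
    rw [div_lt_div_iff₀ hr0 (by positivity)] at h1
    rw [div_mul_eq_mul_div, div_le_iff₀ hn] at h2
    linarith
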